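/- For every ϖ ∈ (1,2] there exists a constant C > 0, depending only on ϖ, with the following property: for any probability space with a discrete-time filtration (F_j)_{j∈ℤ≥0}, any adapted sequence (ζ_j)_{j≥1} of random variables with E[|ζ_j|^ϖ] < ∞, and any bounded ℤ≥0-valued (F_j)-stopping time T, one has E[ | Σ_{j=1}^{T} ( ζ_j − E[ζ_j | F_{j−1}] ) |^ϖ ] ≤ C · E[ Σ_{j=1}^{T} E[ |ζ_j|^ϖ | F_{j−1} ] ]. -/

import Mathlib

open MeasureTheory Filter Set

noncomputable section

lemma aux_abs_add (p : ℝ) (hp1 : 1 < p) (hp2 : p ≤ 2) (x y : ℝ) :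
    |x + y| ^ p ≤ 4 * (|x| ^ p + |y| ^ p) := by
  have key : ∀ a b : ℝ, |a| ≤ |b| → |a + b| ^ p ≤ 4 * |b| ^ p := by
    intro a b hab
    have h1 : |a + b| ≤ 2 * |b| := by linarith [abs_add_le a b]
    calc |a + b| ^ p ≤ (2 * |b|) ^ p := Real.rpow_le_rpow (abs_nonneg _) h1 (by linarith)
      _ = 2 ^ p * |b| ^ p := Real.mul_rpow (by norm_num) (abs_nonneg _)
      _ ≤ 4 * |b| ^ p := by
        gcongr
        calc (2 : ℝ) ^ p ≤ 2 ^ (2 : ℝ) := Real.rpow_le_rpow_of_exponent_le (by norm_num) hp2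
          _ = 4 := by norm_num
  have hx := Real.rpow_nonneg (abs_nonneg x) p
  have hy := Real.rpow_nonneg (abs_nonneg y) p
  rcases le_total |x| |y| with h | h
  · linarith [key x y h]
  · have := key y x h
    rw [add_comm y x] at this
    linarith

lemma aux_cross_bound (p : ℝ) (hp1 : 1 < p) (x y : ℝ) :
    |(|x| ^ p / x * y)| ≤ |x| ^ p + |y| ^ p := by
  have hx := Real.rpow_nonneg (abs_nonneg x) p
  have hy := Real.rpow_nonneg (abs_nonneg y) p
  by_cases h0 : x = 0
  · subst h0; simp; positivity
  have hx0 : 0 < |x| := abs_pos.mpr h0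
  rw [abs_mul, abs_div, abs_of_nonneg hx]
  have e : |x| ^ p / |x| = |x| ^ (p - 1) := by rw [Real.rpow_sub hx0, Real.rpow_one]
  rcases le_total |y| |x| with h | h
  · have : |x| ^ p / |x| * |y| ≤ |x| ^ p / |x| * |x| := by gcongr
    rw [div_mul_cancel₀ _ hx0.ne'] at this
    linarith
  · have hy0 : 0 < |y| := hx0.trans_le h
    have : |x| ^ (p - 1) * |y| ≤ |y| ^ (p - 1) * |y| := by
      gcongr
    have e2 : |y| ^ (p - 1) * |y| = |y| ^ p := by
      rw [Real.rpow_sub hy0, Real.rpow_one, div_mul_cancel₀ _ hy0.ne']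
    rw [e]; linarith

lemma aux_key (p : ℝ) (hp1 : 1 < p) (hp2 : p ≤ 2) (x y : ℝ) :
    |x + y| ^ p ≤ |x| ^ p + p * (|x| ^ p / x * y) + 12 * |y| ^ p := by
  have hx := Real.rpow_nonneg (abs_nonneg x) p
  have hy := Real.rpow_nonneg (abs_nonneg y) p
  rcases lt_or_ge |x| |y| with h | h
  · have h1 := aux_abs_add p hp1 hp2 x y
    have h2 := neg_le_of_abs_le (aux_cross_bound p hp1 x y)
    have h3 : |x| ^ p ≤ |y| ^ p := Real.rpow_le_rpow (abs_nonneg _) h.le (by linarith)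
    have h4 : |x + y| ^ p ≤ 8 * |y| ^ p := by linarith
    have h5 : -(p * (|x| ^ p + |y| ^ p)) ≤ p * (|x| ^ p / x * y) := by nlinarith
    have h6 : |x| ^ p * (p - 1) ≤ |y| ^ p * (p - 1) := by gcongr
    have h7 : |y| ^ p * p ≤ |y| ^ p * 2 := by gcongr
    nlinarith
  · by_cases h0 : x = 0
    · subst h0
      have : y = 0 := by simpa using h
      subst this
      simp [Real.zero_rpow (by linarith : p ≠ 0)]
    have hx0 : 0 < |x| := abs_pos.mpr h0
    set t := y / x with ht
    have hy' : y = x * t := by rw [ht]; field_simp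
    have htabs : |t| ≤ 1 := by rw [ht, abs_div]; exact div_le_one_of_le₀ h hx0.le
    have ht1 := abs_le.mp htabs
    have hB := rpow_one_add_le_one_add_mul_self ht1.1 (p := p - 1) (by linarith) (by linarith)
    have e1 : |x + y| ^ p = |x| ^ p * (1 + t) ^ p := by
      rw [hy', show x + x * t = x * (1 + t) by ring, abs_mul,
        Real.mul_rpow (abs_nonneg _) (abs_nonneg _), abs_of_nonneg (by linarith : 0 ≤ 1 + t)]
    have e2 : |y| ^ p = |x| ^ p * |t| ^ p := by
      rw [hy', abs_mul, Real.mul_rpow (abs_nonneg _) (abs_nonneg _)]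
    have e3 : |x| ^ p / x * y = |x| ^ p * t := by rw [hy']; field_simp
    have e4 : (1 + t) ^ p = (1 + t) ^ (p - 1) * (1 + t) := by
      rcases eq_or_lt_of_le (by linarith : 0 ≤ 1 + t) with h | h
      · rw [← h]; simp [Real.zero_rpow (by linarith : p ≠ 0)]
      · rw [Real.rpow_sub h, Real.rpow_one, div_mul_cancel₀ _ h.ne']
    have e5 : t ^ 2 ≤ |t| ^ p := by
      rw [← sq_abs, ← Real.rpow_natCast]
      rcases eq_or_lt_of_le (abs_nonneg t) with h | h
      · rw [← h]; simp [Real.zero_rpow (by linarith : p ≠ 0)]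
      · exact Real.rpow_le_rpow_of_exponent_ge h htabs (by simpa using hp2)
    have e6 : (1 + t) ^ p ≤ 1 + p * t + |t| ^ p := by
      rw [e4]
      have : (1 + t) ^ (p - 1) * (1 + t) ≤ (1 + (p - 1) * t) * (1 + t) := by
        gcongr
        linarith
      nlinarith [sq_nonneg t]
    have ht0 := Real.rpow_nonneg (abs_nonneg t) p
    rw [e1, e2, e3]
    have : |x| ^ p * (1 + t) ^ p ≤ |x| ^ p * (1 + p * t + |t| ^ p) := by gcongr
    nlinarith [mul_nonneg hx ht0]

lemma aux_integrable {Ω : Type} {m0 : MeasurableSpace Ω} {μ : Measure Ω} [IsProbabilityMeasure μ]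
    (p : ℝ) (hp1 : 1 < p) (Z : Ω → ℝ) (hZ : AEStronglyMeasurable Z μ)
    (hi : Integrable (fun ω => |Z ω| ^ p) μ) : Integrable Z μ := by
  refine ((integrable_const (1 : ℝ)).add hi).mono' hZ ?_
  filter_upwards with ω
  have h0 := Real.rpow_nonneg (abs_nonneg (Z ω)) p
  simp only [Pi.add_apply, Real.norm_eq_abs]
  rcases le_total |Z ω| 1 with h | h
  · linarith
  · have := Real.rpow_le_rpow_of_exponent_le h hp1.le
    rw [Real.rpow_one] at this
    linarith

lemma aux_step {Ω : Type} (m : MeasurableSpace Ω) {m0 : MeasurableSpace Ω} {μ : Measure Ω} [IsProbabilityMeasure μ]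
    (p : ℝ) (hp1 : 1 < p) (hp2 : p ≤ 2) (hm : m ≤ m0)
    (X Z : Ω → ℝ) (A : Set Ω) (hA : MeasurableSet[m] A)
    (hX : StronglyMeasurable[m] X) (hZ : StronglyMeasurable Z)
    (hXi : Integrable (fun ω => |X ω| ^ p) μ) (hZi : Integrable (fun ω => |Z ω| ^ p) μ) :
    Integrable (fun ω => |X ω + A.indicator (fun ω => Z ω - (μ[Z | m]) ω) ω| ^ p) μ ∧
    ∫ ω, |X ω + A.indicator (fun ω => Z ω - (μ[Z | m]) ω) ω| ^ p ∂μ ≤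
      ∫ ω, |X ω| ^ p ∂μ + 96 * ∫ ω, A.indicator (μ[fun ω => |Z ω| ^ p | m]) ω ∂μ := by
  have hA0 : MeasurableSet A := hm A hA
  set E := μ[Z | m] with hE
  set G := μ[fun ω => |Z ω| ^ p | m] with hG
  have hEm : StronglyMeasurable[m] E := stronglyMeasurable_condExp
  have hEm0 : Measurable E := (hEm.mono hm).measurable
  have hXm0 : Measurable X := (hX.mono hm).measurable
  have hZm0 : Measurable Z := hZ.measurable
  have hZ1 : Integrable Z μ := aux_integrable p hp1 Z hZ.aestronglyMeasurable hZi
  have hGi : Integrable G μ := integrable_condExp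
  have hJ : ∀ᵐ ω ∂μ, |E ω| ^ p ≤ G ω :=
    Integrable.norm_condExp_rpow_le (f := Z) (m := m) hp1.le hZi
  set D : Ω → ℝ := fun ω => Z ω - E ω with hD
  set Y : Ω → ℝ := A.indicator D with hY
  have hDm : Measurable D := hZm0.sub hEm0
  have hYm : Measurable Y := hDm.indicator hA0
  have hDi : Integrable D μ := hZ1.sub integrable_condExp
  have hp0 : p ≠ 0 := by linarith
  have hYb : ∀ᵐ ω ∂μ, |Y ω| ^ p ≤
      4 * (A.indicator (fun ω => |Z ω| ^ p) ω + A.indicator G ω) := by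
    filter_upwards [hJ] with ω h
    by_cases hω : ω ∈ A
    · simp only [hY, hω, indicator_of_mem, hD]
      have := aux_abs_add p hp1 hp2 (Z ω) (-E ω)
      rw [abs_neg, ← sub_eq_add_neg] at this
      linarith
    · simp [hY, hω, Real.zero_rpow hp0]
  have hZA : Integrable (A.indicator (fun ω => |Z ω| ^ p)) μ := hZi.indicator hA0
  have hGA : Integrable (A.indicator G) μ := hGi.indicator hA0
  have hYi : Integrable (fun ω => |Y ω| ^ p) μ := by
    refine ((hZA.add hGA).const_mul 4).mono' (Measurable.aestronglyMeasurable (by fun_prop)) ?_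
    filter_upwards [hYb] with ω h
    rw [Real.norm_of_nonneg (by positivity)]
    exact h
  have hYint : ∫ ω, |Y ω| ^ p ∂μ ≤ 8 * ∫ ω, A.indicator G ω ∂μ := by
    have h1 := integral_mono_ae hYi ((hZA.add hGA).const_mul 4) hYb
    have h2 : ∫ ω, A.indicator (fun ω => |Z ω| ^ p) ω ∂μ = ∫ ω, A.indicator G ω ∂μ := by
      rw [integral_indicator hA0, integral_indicator hA0, hG, setIntegral_condExp hm hZi hA]
    have h3 : ∫ ω, 4 * (A.indicator (fun ω => |Z ω| ^ p) ω + A.indicator G ω) ∂μ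
        = 8 * ∫ ω, A.indicator G ω ∂μ := by
      rw [integral_const_mul, integral_add hZA hGA, h2]; ring
    exact h1.trans h3.le
  have hXY : Integrable (fun ω => |X ω + Y ω| ^ p) μ := by
    refine ((hXi.add hYi).const_mul 4).mono' (Measurable.aestronglyMeasurable (by fun_prop)) ?_
    filter_upwards with ω
    rw [Real.norm_of_nonneg (by positivity)]
    exact aux_abs_add p hp1 hp2 _ _
  have hcr : Integrable (fun ω => |X ω| ^ p / X ω * Y ω) μ := by
    refine (hXi.add hYi).mono' (by fun_prop) ?_
    filter_upwards with ω
    exact aux_cross_bound p hp1 _ _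
  -- the cross term vanishes
  set H : Ω → ℝ := A.indicator (fun ω => |X ω| ^ p / X ω) with hH
  have hHm : StronglyMeasurable[m] H := by
    have hX' : Measurable[m] X := hX.measurable
    refine StronglyMeasurable.indicator ?_ hA
    refine Measurable.stronglyMeasurable ?_
    fun_prop
  have hHD : (fun ω => |X ω| ^ p / X ω * Y ω) = H * D := by
    ext ω
    by_cases hω : ω ∈ A <;> simp [hH, hY, hω]
  have hcr0 : ∫ ω, |X ω| ^ p / X ω * Y ω ∂μ = 0 := by
    rw [hHD] at hcr ⊢
    rw [← integral_condExp hm]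
    have h1 := condExp_mul_of_stronglyMeasurable_left hHm hcr hDi
    have h2 : μ[D | m] =ᵐ[μ] μ[Z | m] - μ[E | m] := condExp_sub hZ1 integrable_condExp m
    have h3 : μ[E | m] = E := condExp_of_stronglyMeasurable hm hEm integrable_condExp
    rw [h3] at h2
    rw [← integral_zero Ω ℝ (μ := μ)]
    apply integral_congr_ae
    filter_upwards [h1, h2] with ω a b
    rw [a, Pi.mul_apply, b]
    simp [hE]
  refine ⟨hXY, ?_⟩
  have hsumi : Integrable (fun ω => |X ω| ^ p + p * (|X ω| ^ p / X ω * Y ω)) μ :=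
    hXi.add (hcr.const_mul p)
  have hmain : ∫ ω, |X ω + Y ω| ^ p ∂μ ≤
      ∫ ω, (|X ω| ^ p + p * (|X ω| ^ p / X ω * Y ω) + 12 * |Y ω| ^ p) ∂μ :=
    integral_mono hXY (hsumi.add (hYi.const_mul 12))
      (fun ω => aux_key p hp1 hp2 _ _)
  rw [integral_add hsumi (hYi.const_mul 12),
    integral_add hXi (hcr.const_mul p), integral_const_mul, integral_const_mul, hcr0] at hmain
  linarith

/-- A Burkholder–Davis–Gundy / Cᵖ type inequality for discrete-time martingale
differences stopped at a bounded stopping time: for every `ϖ ∈ (1,2]` there is a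
universal constant `C` such that
`E[ |Σ_{j=1}^{T} (ζ_j − E[ζ_j | F_{j−1}])|^ϖ ] ≤ C · E[ Σ_{j=1}^{T} E[|ζ_j|^ϖ | F_{j−1}] ]`. -/
theorem discrete_bdg_bound (ϖ : ℝ) (hϖ1 : 1 < ϖ) (hϖ2 : ϖ ≤ 2) :
    ∃ C : ℝ, 0 < C ∧
      ∀ (Ω : Type) (m0 : MeasurableSpace Ω) (μ : Measure Ω), IsProbabilityMeasure μ →
        ∀ (F : Filtration ℕ m0) (ζ : ℕ → Ω → ℝ),
          (∀ j : ℕ, StronglyMeasurable[F (j + 1)] (ζ (j + 1))) →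
          (∀ j : ℕ, Integrable (fun ω => |ζ (j + 1) ω| ^ ϖ) μ) →
          ∀ (T : Ω → ℕ), IsStoppingTime F (fun ω => (T ω : WithTop ℕ)) → (∃ m : ℕ, ∀ ω, T ω ≤ m) →
            ∫ ω, |∑ j ∈ Finset.range (T ω), (ζ (j + 1) ω - (μ[ζ (j + 1) | F j]) ω)| ^ ϖ ∂μ
              ≤ C * ∫ ω, ∑ j ∈ Finset.range (T ω),
                  (μ[fun ω' => |ζ (j + 1) ω'| ^ ϖ | F j]) ω ∂μ := by
  refine ⟨96, by norm_num, ?_⟩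
  intro Ω m0 μ hμ F ζ hζ hζi T hT ⟨m, hTm⟩
  set A : ℕ → Set Ω := fun j => {ω | j < T ω} with hAdef
  have hA : ∀ j, MeasurableSet[F j] (A j) := by
    intro j
    have := hT.measurableSet_gt j
    convert this using 1
    ext ω
    simp [hAdef]
  set D : ℕ → Ω → ℝ := fun j => (A j).indicator (fun ω => ζ (j + 1) ω - (μ[ζ (j + 1) | F j]) ω)
    with hD
  set G : ℕ → Ω → ℝ := fun j => (A j).indicator (μ[fun ω' => |ζ (j + 1) ω'| ^ ϖ | F j]) with hG
  have hsum : ∀ (f : ℕ → Ω → ℝ) ω, ∑ j ∈ Finset.range (T ω), f j ω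
      = ∑ j ∈ Finset.range m, (A j).indicator (f j) ω := by
    intro f ω
    have hsub : Finset.range (T ω) ⊆ Finset.range m := Finset.range_mono (hTm ω)
    rw [← Finset.sum_subset hsub]
    · refine Finset.sum_congr rfl fun j hj => ?_
      have : ω ∈ A j := Finset.mem_range.mp hj
      simp [this]
    · intro j _ hj
      have : ω ∉ A j := fun h => hj (Finset.mem_range.mpr h)
      simp [this]
  have hGi : ∀ j, Integrable (G j) μ := fun j =>
    integrable_condExp.indicator (F.le j _ (hA j))
  have hind : ∀ n, StronglyMeasurable[F n] (fun ω => ∑ j ∈ Finset.range n, D j ω) ∧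
      Integrable (fun ω => |∑ j ∈ Finset.range n, D j ω| ^ ϖ) μ ∧
      ∫ ω, |∑ j ∈ Finset.range n, D j ω| ^ ϖ ∂μ
        ≤ 96 * ∑ j ∈ Finset.range n, ∫ ω, G j ω ∂μ := by
    intro n
    induction n with
    | zero =>
      have h0 : ϖ ≠ 0 := by linarith
      simp [Real.zero_rpow h0, stronglyMeasurable_const]
    | succ n ih =>
      obtain ⟨h1, h2, h3⟩ := ih
      have hle : F n ≤ F (n + 1) := F.mono (Nat.le_succ n)
      obtain ⟨h4, h5⟩ := aux_step (F n) ϖ hϖ1 hϖ2 (F.le n) _ (ζ (n + 1)) (A n) (hA n) h1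
        ((hζ n).mono (F.le _)) h2 (hζi n)
      simp only [Finset.sum_range_succ]
      refine ⟨?_, h4, ?_⟩
      · refine (h1.mono hle).add ?_
        exact ((hζ n).sub (stronglyMeasurable_condExp.mono hle)).indicator (hle _ (hA n))
      · refine h5.trans ?_
        rw [mul_add]
        exact add_le_add h3 le_rfl
  have hL := (hind m).2.2
  rw [← integral_finsetSum _ (fun j _ => hGi j)] at hL
  have e1 : ∀ ω, ∑ j ∈ Finset.range (T ω), (ζ (j + 1) ω - (μ[ζ (j + 1) | F j]) ω)
      = ∑ j ∈ Finset.range m, D j ω :=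
    hsum (fun j ω => ζ (j + 1) ω - (μ[ζ (j + 1) | F j]) ω)
  have e2 : ∀ ω, ∑ j ∈ Finset.range (T ω), (μ[fun ω' => |ζ (j + 1) ω'| ^ ϖ | F j]) ω
      = ∑ j ∈ Finset.range m, G j ω :=
    hsum (fun j ω => (μ[fun ω' => |ζ (j + 1) ω'| ^ ϖ | F j]) ω)
  simp only [e1, e2]
  exact hL

end
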